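/- arXiv:1510.08838 — 2 statements merged into one kernel-verified Lean document; each statement's English description precedes it below -/
import Mathlib

section
/- Let H and K be groups and let φ : K →* MulAut H be an action of K on H by automorphisms. Let N be the subgroup of the abelianization of H generated by the elements Abelianization.of h * (Abelianization.of (φ k h))⁻¹ for all h ∈ H and k ∈ K (this subgroup is normal since Abelianization H is abelian). Then the abelianization of the semidirect product H ⋊[φ] K is isomorphic, as a group, to the direct product ((Abelianization H) ⧸ N) × (Abelianization K). -/
/-- The map from a semidirect product to the coinvariants of the abelianization of the normal
factor times the abelianization of the acting group. -/
def semidirectProductToCoinvariantsProd {H K : Type*} [Group H] [Group K]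
    (φ : K →* MulAut H) (N : Subgroup (Abelianization H))
    (hN : ∀ h k, Abelianization.of h * (Abelianization.of (φ k h))⁻¹ ∈ N) :
    H ⋊[φ] K →* (Abelianization H ⧸ N) × Abelianization K :=
  SemidirectProduct.lift
    ((MonoidHom.inl _ _).comp ((QuotientGroup.mk' N).comp Abelianization.of))
    ((MonoidHom.inr _ _).comp Abelianization.of)
    (fun k => by
      ext h
      · have key : (QuotientGroup.mk' N) (Abelianization.of (φ k h)) =
            (QuotientGroup.mk' N) (Abelianization.of h) := by
          refine QuotientGroup.eq.2 ?_
          rw [mul_comm]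
          exact hN h k
        simpa using key
      · simp)

/-- The map induced on coinvariants of `Abelianization H` by the inclusion of `H` into the
semidirect product. -/
def coinvariantsToAbelianization {H K : Type*} [Group H] [Group K]
    (φ : K →* MulAut H) (N : Subgroup (Abelianization H))
    (hN : N ≤ (Abelianization.map (SemidirectProduct.inl : H →* H ⋊[φ] K)).ker) :
    Abelianization H ⧸ N →* Abelianization (H ⋊[φ] K) :=
  QuotientGroup.lift N (Abelianization.map SemidirectProduct.inl) hN

theorem closure_le_ker_map_inl {H K : Type*} [Group H] [Group K] (φ : K →* MulAut H) :
    Subgroup.closure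
      {x : Abelianization H | ∃ (h : H) (k : K),
        x = Abelianization.of h * (Abelianization.of (φ k h))⁻¹} ≤
      (Abelianization.map (SemidirectProduct.inl : H →* H ⋊[φ] K)).ker := by
  rw [Subgroup.closure_le]
  rintro _ ⟨h, k, rfl⟩
  simp [MonoidHom.mem_ker, SemidirectProduct.inl_aut, mul_comm]

/-- The abelianization of a semidirect product `H ⋊[φ] K` is isomorphic to the product of
`Abelianization K` with the quotient of `Abelianization H` by the subgroup generated by the
elements `Abelianization.of h * (Abelianization.of (φ k h))⁻¹`. -/
theorem abelianization_semidirectProduct {H K : Type*} [Group H] [Group K]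
    (φ : K →* MulAut H) (N : Subgroup (Abelianization H))
    (hN : N = Subgroup.closure
      {x : Abelianization H | ∃ (h : H) (k : K),
        x = Abelianization.of h * (Abelianization.of (φ k h))⁻¹}) :
    Nonempty (Abelianization (H ⋊[φ] K) ≃* ((Abelianization H ⧸ N) × Abelianization K)) := by
  have mem : ∀ h k, Abelianization.of h * (Abelianization.of (φ k h))⁻¹ ∈ N := fun h k =>
    hN ▸ Subgroup.subset_closure ⟨h, k, rfl⟩
  have le : N ≤ (Abelianization.map (SemidirectProduct.inl : H →* H ⋊[φ] K)).ker :=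
    hN ▸ closure_le_ker_map_inl φ
  refine ⟨MonoidHom.toMulEquiv
    (Abelianization.lift (semidirectProductToCoinvariantsProd φ N mem))
    (MonoidHom.coprod (coinvariantsToAbelianization φ N le)
      (Abelianization.map SemidirectProduct.inr)) ?_ ?_⟩
  · refine Abelianization.hom_ext _ _ (SemidirectProduct.hom_ext ?_ ?_) <;> ext x <;>
      simp [semidirectProductToCoinvariantsProd, coinvariantsToAbelianization]
  · refine MonoidHom.ext fun ⟨x, y⟩ => ?_
    obtain ⟨x, rfl⟩ := QuotientGroup.mk'_surjective N x
    obtain ⟨h, rfl⟩ := QuotientGroup.mk_surjective x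
    obtain ⟨k, rfl⟩ := QuotientGroup.mk_surjective y
    change Abelianization.lift (semidirectProductToCoinvariantsProd φ N mem)
      (Abelianization.of (SemidirectProduct.inl h) *
        Abelianization.of (SemidirectProduct.inr k)) =
      (QuotientGroup.mk' N (Abelianization.of h), Abelianization.of k)
    simp [semidirectProductToCoinvariantsProd]
end

section
/- For every natural number m there exists a finite solvable group G whose minimal number of generators exceeds the minimal number of generators of its abelianization by exactly m: there exists a group G that is finite and solvable, with Group.rank G − Group.rank (Abelianization G) = m (equivalently, Group.rank G = Group.rank (Abelianization G) + m). In particular, the gap d(G) − d(G/[G,G]) can be made arbitrarily large among finite solvable groups. -/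
namespace ScalarSemidirect

open SemidirectProduct Multiplicative
open scoped commutatorElement

variable (K V : Type) [Field K] [AddCommGroup V] [Module K V]

/-- The action of `Kˣ` on `V` by scalar multiplication. -/
def scalarAction : Kˣ →* MulAut (Multiplicative V) :=
  (MulAutMultiplicative V).symm.toMonoidHom.comp (DistribMulAction.toAddAut Kˣ V)

/-- The semidirect product of the additive group of `V` by `Kˣ` acting by scalars. -/
abbrev ScalarGroup : Type := Multiplicative V ⋊[scalarAction K V] Kˣ

variable {K V}

lemma toAdd_scalarAction (u : Kˣ) (x : Multiplicative V) :
    (scalarAction K V u x).toAdd = (u : K) • x.toAdd := rfl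

instance [Finite K] [Finite V] : Finite (ScalarGroup K V) :=
  Finite.of_equiv _ SemidirectProduct.equivProd.symm

lemma isSolvable : Group.IsSolvable (ScalarGroup K V) :=
  Group.isSolvable_of_ker_le_range inl rightHom range_inl_eq_ker_rightHom.ge

lemma commutator_eq_ker {u : Kˣ} (hu : u ≠ 1) :
    commutator (ScalarGroup K V) = (rightHom : ScalarGroup K V →* Kˣ).ker := by
  refine le_antisymm (Abelianization.commutator_subset_ker _) ?_
  rw [← range_inl_eq_ker_rightHom]
  rintro _ ⟨x, rfl⟩
  have hu' : (u : K) - 1 ≠ 0 := sub_ne_zero.2 fun h => hu (Units.ext h)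
  have h : (inl x : ScalarGroup K V) =
      ⁅(inr u : ScalarGroup K V), inl (ofAdd (((u : K) - 1)⁻¹ • x.toAdd))⁆ := by
    rw [commutatorElement_def, ← map_inv (inr : Kˣ →* ScalarGroup K V), ← inl_aut, ← map_inv,
      ← map_mul]
    congr 1
    apply toAdd.injective
    rw [toAdd_mul, toAdd_scalarAction, toAdd_inv, toAdd_ofAdd, ← sub_eq_add_neg]
    calc x.toAdd = ((u : K) - 1) • ((u : K) - 1)⁻¹ • x.toAdd := (smul_inv_smul₀ hu' _).symm
      _ = _ := by rw [sub_smul, one_smul]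
  rw [h]
  exact Subgroup.commutator_mem_commutator trivial trivial

/-- The subgroup of elements whose value under the principal cocycle shift by `b` lies in `W`. -/
def shiftSubgroup (b : V) (W : Submodule K V) : Subgroup (ScalarGroup K V) where
  carrier := {g | g.left.toAdd - (1 - (g.right : K)) • b ∈ W}
  one_mem' := by simp
  mul_mem' {g h} hg hh := by
    have key : (g * h).left.toAdd - (1 - ((g * h).right : K)) • b =
        (g.left.toAdd - (1 - (g.right : K)) • b) +
          (g.right : K) • (h.left.toAdd - (1 - (h.right : K)) • b) := by
      rw [mul_left, mul_right, toAdd_mul, toAdd_scalarAction, Units.val_mul]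
      module
    rw [Set.mem_ofPred_eq, key]
    exact W.add_mem hg (W.smul_mem _ hh)
  inv_mem' {g} hg := by
    have key : g⁻¹.left.toAdd - (1 - (g⁻¹.right : K)) • b =
        -((g.right⁻¹ : Kˣ) : K) • (g.left.toAdd - (1 - (g.right : K)) • b) := by
      rw [inv_left, inv_right, toAdd_scalarAction, toAdd_inv, smul_sub, smul_smul]
      have : ((g.right⁻¹ : Kˣ) : K) * g.right = 1 := Units.inv_mul _
      rw [neg_mul, mul_sub, this]
      module
    rw [Set.mem_ofPred_eq, key]
    exact W.smul_mem _ hg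

lemma mem_shiftSubgroup {b : V} {W : Submodule K V} {g : ScalarGroup K V} :
    g ∈ shiftSubgroup b W ↔ g.left.toAdd - (1 - (g.right : K)) • b ∈ W := Iff.rfl

lemma finrank_lt_card_of_closure_eq_top [Nontrivial Kˣ] (S : Finset (ScalarGroup K V))
    (hS : Subgroup.closure (S : Set (ScalarGroup K V)) = ⊤) :
    Module.finrank K V < S.card := by
  classical
  obtain ⟨s, hs, hs1⟩ : ∃ s ∈ S, s.right ≠ 1 := by
    by_contra! h
    obtain ⟨u, hu⟩ := exists_ne (1 : Kˣ)
    have hle : Subgroup.closure (S : Set (ScalarGroup K V)) ≤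
        (rightHom : ScalarGroup K V →* Kˣ).ker := (Subgroup.closure_le _).2 h
    rw [hS] at hle
    exact hu (hle (Subgroup.mem_top (inr u)))
  have hs0 : 1 - (s.right : K) ≠ 0 := sub_ne_zero.2 fun h => hs1 (Units.ext h.symm)
  let b : V := (1 - (s.right : K))⁻¹ • s.left.toAdd
  let T : Finset V := (S.erase s).image fun g => g.left.toAdd - (1 - (g.right : K)) • b
  have hle : Subgroup.closure (S : Set (ScalarGroup K V)) ≤
      shiftSubgroup b (Submodule.span K (T : Set V)) := by
    refine (Subgroup.closure_le _).2 fun g hg => ?_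
    rw [SetLike.mem_coe, mem_shiftSubgroup]
    by_cases hgs : g = s
    · simp [hgs, b, smul_inv_smul₀ hs0]
    · exact Submodule.subset_span (Finset.mem_image_of_mem _ (Finset.mem_erase.2 ⟨hgs, hg⟩))
  have htop : Submodule.span K (T : Set V) = ⊤ := by
    rw [hS] at hle
    refine eq_top_iff.2 fun x _ => ?_
    simpa [mem_shiftSubgroup] using hle (Subgroup.mem_top (inl (ofAdd x)))
  calc Module.finrank K V = Module.finrank K (Submodule.span K (T : Set V)) := by
        rw [htop, finrank_top]
    _ ≤ T.card := finrank_span_finset_le_card T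
    _ ≤ (S.erase s).card := Finset.card_image_le
    _ < S.card := Finset.card_erase_lt_of_mem hs

lemma rank_units [Finite K] [Nontrivial Kˣ] : Group.rank Kˣ = 1 := by
  refine le_antisymm ?_ ?_
  · obtain ⟨u, hu⟩ := IsCyclic.exists_generator (α := Kˣ)
    refine Group.rank_le (S := {u}) ?_
    rw [Finset.coe_singleton, ← Subgroup.zpowers_eq_closure]
    exact eq_top_iff.2 fun x _ => hu x
  · rw [Nat.one_le_iff_ne_zero, Ne, Group.rank_eq_zero_iff, not_subsingleton_iff_nontrivial]
    infer_instance

lemma rank_abelianization [Finite K] [Finite V] [Nontrivial Kˣ] :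
    Group.rank (Abelianization (ScalarGroup K V)) = 1 := by
  obtain ⟨u, hu⟩ := exists_ne (1 : Kˣ)
  rw [← rank_units (K := K)]
  exact Group.rank_congr ((QuotientGroup.quotientMulEquivOfEq (commutator_eq_ker hu)).trans
    (QuotientGroup.quotientKerEquivOfSurjective _ rightHom_surjective))

lemma rank_le (q m : ℕ) [Fact q.Prime] :
    Group.rank (ScalarGroup (ZMod q) (Fin m → ZMod q)) ≤ m + 1 := by
  classical
  obtain ⟨u, hu⟩ := IsCyclic.exists_generator (α := (ZMod q)ˣ)
  let e (i : Fin m) : ScalarGroup (ZMod q) (Fin m → ZMod q) := inl (ofAdd (Pi.single i 1))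
  let S : Finset (ScalarGroup (ZMod q) (Fin m → ZMod q)) := insert (inr u) (Finset.univ.image e)
  have hS : Subgroup.closure (S : Set (ScalarGroup (ZMod q) (Fin m → ZMod q))) = ⊤ := by
    refine eq_top_iff.2 fun g _ => ?_
    rw [← inl_left_mul_inr_right g]
    refine mul_mem ?_ ?_
    · have hg : g.left = ∏ i, ofAdd (Pi.single i (1 : ZMod q)) ^ (g.left.toAdd i).val := by
        apply toAdd.injective
        rw [toAdd_prod]
        refine (Finset.univ_sum_single g.left.toAdd).symm.trans (Finset.sum_congr rfl fun i _ => ?_)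
        rw [toAdd_pow, toAdd_ofAdd, ← Pi.single_smul, nsmul_one, ZMod.natCast_zmod_val]
      rw [← Subgroup.mem_comap, hg]
      refine Subgroup.prod_mem _ fun i _ => pow_mem ?_ _
      exact Subgroup.subset_closure (by simp [S, e])
    · obtain ⟨k, hk⟩ := hu g.right
      rw [← hk]
      simp only [map_zpow]
      exact zpow_mem (Subgroup.subset_closure (by simp [S])) _
  calc Group.rank (ScalarGroup (ZMod q) (Fin m → ZMod q)) ≤ S.card := Group.rank_le hS
    _ ≤ (Finset.univ.image e).card + 1 := Finset.card_insert_le _ _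
    _ ≤ m + 1 := by simpa using Finset.card_image_le (s := Finset.univ) (f := e)

end ScalarSemidirect

/-- For every natural number `m` there exists a finite solvable group `G` whose minimal number
of generators exceeds the minimal number of generators of its abelianization by exactly `m`. -/
theorem exists_finite_solvable_rank_gap (m : ℕ) :
    ∃ (G : Type) (inst : Group G) (instFin : Finite G),
      letI := inst
      letI := instFin
      IsSolvable G ∧ Group.rank G = Group.rank (Abelianization G) + m := by
  have : Nontrivial (ZMod 3)ˣ := ⟨⟨1, -1, by decide⟩⟩
  refine ⟨ScalarSemidirect.ScalarGroup (ZMod 3) (Fin m → ZMod 3), inferInstance, inferInstance,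
    ScalarSemidirect.isSolvable, ?_⟩
  obtain ⟨S, hS, hS'⟩ := Group.rank_spec (ScalarSemidirect.ScalarGroup (ZMod 3) (Fin m → ZMod 3))
  have h := ScalarSemidirect.finrank_lt_card_of_closure_eq_top S hS'
  rw [Module.finrank_fin_fun, hS] at h
  rw [ScalarSemidirect.rank_abelianization, add_comm]
  exact le_antisymm (ScalarSemidirect.rank_le 3 m) h
end
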